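/- Let K = [[0,1],[−1,0]], let T > 0, σ > 0, τ > 0, s > 0, κ > 0, C_b > 0 and b₀ ≠ 0. Then there exist constants C > 0 and λ₀ > 0 such that the following holds. Let ε ∈ (0,1], Δt > 0 and N ∈ ℕ satisfy NΔt = T and Δt/ε² ≥ λ₀; set δ = Δt/ε and λ = Δt/ε². Let E : ℝ² → ℝ² satisfy |E(y)| ≤ κ and |E(y) − E(y′)| ≤ κ|y − y′| for all y, y′, and let b̃ : ℝ² → ℝ satisfy |b̃(z) − b₀| ≤ C_b ε^s for all z ∈ ℝ². Let ξ₀, …, ξ_{N−1} ∈ ℝ² and set M_ξ = max_{0 ≤ n < N} |ξₙ|. Given x⁰, v⁰ ∈ ℝ², define (xⁿ, vⁿ) by the APSI1 recursion vⁿ⁺¹ = M(xⁿ)(vⁿ + δE(xⁿ) + √(2σδ/τ) ξₙ), xⁿ⁺¹ = xⁿ + δvⁿ⁺¹, with M(y) = ((1+δ/τ)I₂ + λ b̃(εy)K)/((1+δ/τ)² + (λ b̃(εy))²), and define uⁿ by u⁰ = x⁰ and uⁿ⁺¹ = uⁿ + Δt (K/b₀) E(uⁿ). Then, with R(y) = (b̃(εy)τ²K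 + ετI₂)/((b̃(εy)τ)² + ε²), one has ‖x^N − u^N‖ ≤ C [ ε² (1 + ‖ε⁻¹v⁰ − R(x⁰)E(x⁰)‖) + M_ξ √(2σε/(τΔt)) + (ε^s τ² + ε² + ετ)/(ε² + τ²) ]. -/

import Mathlib

/-- Euclidean norm on `ℝ²` (realized as `Fin 2 → ℝ`). -/
noncomputable def enorm2 (w : Fin 2 → ℝ) : ℝ := Real.sqrt (∑ i : Fin 2, w i ^ 2)

/-- The identification of `ℝ²` with `ℂ`, under which `K` becomes multiplication by `-I`. -/
def planeToComplex : (Fin 2 → ℝ) →ₗ[ℝ] ℂ where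
  toFun w := ⟨w 0, w 1⟩
  map_add' _ _ := rfl
  map_smul' r w := by apply Complex.ext <;> simp

lemma norm_planeToComplex (w : Fin 2 → ℝ) : ‖planeToComplex w‖ = enorm2 w := by
  simp [planeToComplex, enorm2, Complex.norm_def, Complex.normSq_apply, pow_two]

lemma planeToComplex_mulVec_rotation (z : Fin 2 → ℝ) :
    planeToComplex ((!![0, 1; -1, 0] : Matrix (Fin 2) (Fin 2) ℝ).mulVec z) =
      -Complex.I * planeToComplex z := by
  apply Complex.ext <;> simp [planeToComplex, dotProduct, Fin.sum_univ_two]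

lemma planeToComplex_mulVec_resolvent (a c : ℝ) (z : Fin 2 → ℝ) :
    planeToComplex (((a ^ 2 + c ^ 2)⁻¹ • (a • (1 : Matrix (Fin 2) (Fin 2) ℝ) +
        c • !![0, 1; -1, 0])).mulVec z) = (a + c * Complex.I : ℂ)⁻¹ * planeToComplex z := by
  rw [Matrix.smul_mulVec, Matrix.add_mulVec, Matrix.smul_mulVec, Matrix.smul_mulVec,
    Matrix.one_mulVec, map_smul, map_add, map_smul, map_smul, planeToComplex_mulVec_rotation,
    Complex.inv_def]
  have : Complex.normSq (a + c * Complex.I : ℂ) = a ^ 2 + c ^ 2 := Complex.normSq_add_mul_I a c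
  rw [this]
  simp only [Complex.real_smul, map_add, map_mul, Complex.conj_ofReal, Complex.conj_I]
  ring

/-- Discrete Grönwall inequality with constant coefficients on a finite range. -/
lemma discrete_gronwall_exp {f : ℕ → ℝ} {a h : ℝ} {N : ℕ} (ha : 0 ≤ a) (hh : 0 ≤ h)
    (hf0 : 0 ≤ f 0) (hf : ∀ n < N, f (n + 1) ≤ (1 + a) * f n + h) :
    ∀ n ≤ N, f n ≤ Real.exp (a * n) * (f 0 + n * h) := by
  intro n
  induction n with
  | zero => simp
  | succ n ih =>
    intro hn
    have h1 := ih (by omega)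
    have h2 := hf n (by omega)
    have h3 : 1 + a ≤ Real.exp a := by linarith [Real.add_one_le_exp a]
    have h4 : Real.exp (a * (n + 1 : ℕ)) = Real.exp a * Real.exp (a * n) := by
      rw [← Real.exp_add]; push_cast; ring_nf
    have h5 : 1 ≤ Real.exp (a * (n + 1 : ℕ)) := Real.one_le_exp (by positivity)
    calc f (n + 1) ≤ (1 + a) * f n + h := h2
      _ ≤ (1 + a) * (Real.exp (a * n) * (f 0 + n * h)) + h := by gcongr
      _ ≤ Real.exp a * (Real.exp (a * n) * (f 0 + n * h)) +
          Real.exp (a * (n + 1 : ℕ)) * h := by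
        gcongr
        exact le_mul_of_one_le_left hh h5
      _ = _ := by rw [h4]; push_cast; ring

/-- A position driven by a velocity relaxing towards `R n * F n` stays close to the forward Euler
iterates of the limit field `k * G n`. -/
lemma norm_sub_le_of_relaxation {x u w F G R m g : ℕ → ℂ} {k : ℂ} {N : ℕ}
    {Δt T q η κ ρ r : ℝ} (hΔ : 0 < Δt) (hN : N * Δt = T) (hT : 0 < T)
    (hq : 0 ≤ q) (hq4 : q ≤ 1 / 4) (hη : 0 ≤ η) (hκ : 0 ≤ κ) (hρ : 0 ≤ ρ)
    (hr : 0 ≤ r)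
    (hw : ∀ n, w (n + 1) - R n * F n = m n * (w n - R n * F n) + g n)
    (hm : ∀ n, ‖m n‖ ≤ q) (hg : ∀ n < N, ‖g n‖ ≤ η)
    (hR : ∀ n, ‖R n‖ ≤ r) (hRk : ∀ n, ‖R n - k‖ ≤ ρ) (hF : ∀ n, ‖F n‖ ≤ κ)
    (hFx : ∀ n, ‖F (n + 1) - F n‖ ≤ κ * ‖x (n + 1) - x n‖)
    (hFG : ∀ n, ‖F n - G n‖ ≤ κ * ‖x n - u n‖)
    (hx : ∀ n, x (n + 1) = x n + Δt * w (n + 1))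
    (hu : ∀ n, u (n + 1) = u n + Δt * (k * G n)) (hxu : x 0 = u 0) :
    ‖x N - u N‖ ≤ Real.exp (‖k‖ * κ * T) *
      (2 * (q * Δt) * ‖w 0 - R 0 * F 0‖ + 4 * T * η + 2 * T * κ * ρ +
        2 * T * (‖k‖ * κ * (r * κ) + 2 * (‖k‖ * κ) ^ 2) * (q * Δt)) := by
  set d : ℕ → ℝ := fun n => ‖w (n + 1) - R n * F n‖ with hd
  set e : ℕ → ℝ := fun n => ‖x n - u n‖ with he
  set L := ‖k‖ * κ with hLdef
  have hL : 0 ≤ L := by positivity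
  set μ := q * Δt with hμdef
  have hμ : 0 ≤ μ := by positivity
  set B := κ * ρ / 2 + (L * (r * κ) + 2 * L ^ 2) * μ + η with hB
  have hB0 : 0 ≤ B := by positivity
  have hdn : ∀ n, 0 ≤ d n := fun n => norm_nonneg _
  have hd0 : 0 < N → d 0 ≤ q * ‖w 0 - R 0 * F 0‖ + η := by
    intro h0
    simp only [hd]
    rw [hw 0]
    refine (norm_add_le _ _).trans (add_le_add ?_ (hg 0 h0))
    rw [norm_mul]
    exact mul_le_mul_of_nonneg_right (hm 0) (norm_nonneg _)
  have hRF : ∀ n, ‖R n * F n‖ ≤ r * κ := fun n => by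
    rw [norm_mul]; exact mul_le_mul (hR n) (hF n) (norm_nonneg _) hr
  have hdiff : ∀ n, q * (‖k‖ * ‖F (n + 1) - F n‖) ≤
      1 / 4 * d n + (L * (r * κ) + 2 * L ^ 2) * μ := by
    intro n
    have hwn : ‖w (n + 1)‖ ≤ d n + r * κ := by
      calc ‖w (n + 1)‖ = ‖(w (n + 1) - R n * F n) + R n * F n‖ := by ring_nf
        _ ≤ _ := (norm_add_le _ _).trans (add_le_add le_rfl (hRF n))
    have hE2 : ‖F (n + 1) - F n‖ ≤ 2 * κ := by
      linarith [norm_sub_le (F (n + 1)) (F n), hF (n + 1), hF n]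
    have hE1 : ‖F (n + 1) - F n‖ ≤ κ * (Δt * (d n + r * κ)) := by
      refine (hFx n).trans ?_
      rw [hx n, add_sub_cancel_left, norm_mul, Complex.norm_real, Real.norm_of_nonneg hΔ.le]
      gcongr
    rcases le_total (L * μ) (1 / 4) with h | h
    · calc q * (‖k‖ * ‖F (n + 1) - F n‖) ≤ q * (‖k‖ * (κ * (Δt * (d n + r * κ)))) := by gcongr
        _ = (L * μ) * d n + L * (r * κ) * μ := by rw [hLdef, hμdef]; ring
        _ ≤ 1 / 4 * d n + (L * (r * κ) + 2 * L ^ 2) * μ := by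
          have := mul_le_mul_of_nonneg_right h (hdn n)
          have : 0 ≤ 2 * L ^ 2 * μ := by positivity
          linarith
    · calc q * (‖k‖ * ‖F (n + 1) - F n‖) ≤ 1 / 4 * (‖k‖ * (2 * κ)) := by gcongr
        _ = L * 2 * (1 / 4) := by rw [hLdef]; ring
        _ ≤ L * 2 * (L * μ) := by gcongr
        _ ≤ 1 / 4 * d n + (L * (r * κ) + 2 * L ^ 2) * μ := by
          have := hdn n
          have : 0 ≤ L * (r * κ) * μ := by positivity
          linarith
  have hdrec : ∀ n, n + 1 < N → d (n + 1) ≤ 1 / 2 * d n + B := by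
    intro n hn
    have h1 : ‖w (n + 1) - R (n + 1) * F (n + 1)‖ ≤
        d n + (2 * (κ * ρ) + ‖k‖ * ‖F (n + 1) - F n‖) := by
      have : w (n + 1) - R (n + 1) * F (n + 1) = (w (n + 1) - R n * F n) +
        ((R n - k) * F n - (R (n + 1) - k) * F (n + 1) - k * (F (n + 1) - F n)) := by ring
      rw [this]
      refine (norm_add_le _ _).trans (add_le_add le_rfl ?_)
      refine (norm_sub_le _ _).trans (add_le_add ?_ (norm_mul _ _).le)
      refine (norm_sub_le _ _).trans ?_
      rw [norm_mul, norm_mul]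
      have a1 := mul_le_mul (hRk n) (hF n) (norm_nonneg _) hρ
      have a2 := mul_le_mul (hRk (n + 1)) (hF (n + 1)) (norm_nonneg _) hρ
      linarith
    have h2 : d (n + 1) ≤ q * (d n + (2 * (κ * ρ) + ‖k‖ * ‖F (n + 1) - F n‖)) + η := by
      simp only [hd]
      rw [hw (n + 1)]
      refine (norm_add_le _ _).trans (add_le_add ?_ (hg _ hn))
      rw [norm_mul]
      exact mul_le_mul (hm _) h1 (norm_nonneg _) hq
    have h3 := hdiff n
    have h4 := mul_le_mul_of_nonneg_right hq4 (hdn n)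
    have h5 := mul_le_mul_of_nonneg_right hq4 (show 0 ≤ 2 * (κ * ρ) by positivity)
    rw [hB]
    linarith
  have herec : ∀ n, e (n + 1) ≤ (1 + Δt * L) * e n + Δt * (d n + κ * ρ) := by
    intro n
    have : x (n + 1) - u (n + 1) = (x n - u n) + Δt * ((w (n + 1) - R n * F n) +
        (R n - k) * F n + k * (F n - G n)) := by
      rw [hx, hu]; ring
    simp only [he]
    rw [this]
    refine (norm_add_le _ _).trans ?_
    rw [norm_mul, Complex.norm_real, Real.norm_of_nonneg hΔ.le]
    have h1 : ‖(w (n + 1) - R n * F n) + (R n - k) * F n + k * (F n - G n)‖ ≤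
        d n + κ * ρ + L * ‖x n - u n‖ := by
      refine (norm_add₃_le).trans ?_
      rw [norm_mul, norm_mul]
      have a1 := mul_le_mul (hRk n) (hF n) (norm_nonneg _) hρ
      have a2 := mul_le_mul_of_nonneg_left (hFG n) (norm_nonneg k)
      simp only [hd, hLdef]
      linarith
    have := mul_le_mul_of_nonneg_left h1 hΔ.le
    linarith
  obtain ⟨M, rfl⟩ : ∃ M, N = M + 1 := by
    refine Nat.exists_eq_succ_of_ne_zero ?_
    rintro rfl
    simp at hN
    linarith
  have hen : ∀ n, 0 ≤ e n := fun n => norm_nonneg _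
  have he0 : e 0 = 0 := by simp [he, hxu]
  have hf := discrete_gronwall_exp (f := fun n => e (n + 1) + Δt * d n) (a := Δt * L)
    (h := Δt * (2 * B + κ * ρ)) (N := M) (by positivity) (by positivity)
    (add_nonneg (hen _) (mul_nonneg hΔ.le (hdn _))) (by
      intro n hn
      have h1 := herec (n + 1)
      have h2 := mul_le_mul_of_nonneg_left (hdrec n (by omega)) hΔ.le
      have h3 : 0 ≤ Δt * L * (Δt * d n) :=
        mul_nonneg (mul_nonneg hΔ.le hL) (mul_nonneg hΔ.le (hdn n))
      linarith) M le_rfl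
  have hMT : M * Δt + Δt = T := by rw [← hN]; push_cast; ring
  have hMΔ : 0 ≤ M * Δt := by positivity
  have hΔT : Δt ≤ T := by linarith
  have hexp : Real.exp (Δt * L * M) ≤ Real.exp (L * T) := by
    refine Real.exp_le_exp.mpr ?_
    have := mul_nonneg hL hΔ.le
    rw [← hMT]
    linarith
  calc e (M + 1) ≤ e (M + 1) + Δt * d M := le_add_of_nonneg_right (mul_nonneg hΔ.le (hdn _))
    _ ≤ _ := hf
    _ ≤ Real.exp (L * T) * (2 * μ * ‖w 0 - R 0 * F 0‖ + 4 * T * η + 2 * T * κ * ρ +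
        2 * T * (L * (r * κ) + 2 * L ^ 2) * μ) := by
      refine mul_le_mul hexp ?_ ?_ (Real.exp_pos _).le
      · have h1 := herec 0
        rw [he0] at h1
        have h2 := mul_le_mul_of_nonneg_left (hd0 (by omega)) hΔ.le
        have h3 := mul_le_mul_of_nonneg_right hΔT hη
        have h4 := mul_le_mul_of_nonneg_right hΔT hB0
        have h5 : T * (2 * B + κ * ρ) = (M * Δt + Δt) * (2 * B + κ * ρ) := by rw [hMT]
        have h6 : T * B = T * (κ * ρ / 2 + (L * (r * κ) + 2 * L ^ 2) * μ + η) := by rw [hB]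
        have h7 : 0 ≤ Δt * B := by positivity
        simp only [zero_add] at h1 ⊢
        rw [hμdef] at *
        linarith
      · have := hen 1
        have := mul_nonneg hΔ.le (hdn 0)
        simp only [zero_add]
        positivity

/-- The symbol `ε + b̃ τ I` is bounded away from zero, uniformly in `ε`. -/
lemma exists_symbol_lower_bound {τ s Cb b₀ : ℝ} (hτ : 0 < τ) (hs : 0 < s) (hCb : 0 < Cb)
    (hb₀ : b₀ ≠ 0) : ∃ p > 0, ∀ ε b : ℝ, 0 < ε → |b - b₀| ≤ Cb * ε ^ s →
      p ≤ ‖(ε + (b * τ : ℝ) * Complex.I : ℂ)‖ := by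
  have hb : 0 < |b₀| := abs_pos.mpr hb₀
  refine ⟨min ((|b₀| / (2 * Cb)) ^ (1 / s)) (|b₀| / 2 * τ), by positivity, ?_⟩
  intro ε b hε h
  rcases le_total ((|b₀| / (2 * Cb)) ^ (1 / s)) ε with h1 | h1
  · refine (min_le_left _ _).trans (h1.trans ?_)
    have := Complex.abs_re_le_norm (ε + (b * τ : ℝ) * Complex.I : ℂ)
    simp only [Complex.add_re, Complex.ofReal_re, Complex.re_ofReal_mul, Complex.I_re, mul_zero,
      add_zero] at this
    exact (le_abs_self _).trans this
  · refine (min_le_right _ _).trans ?_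
    have h2 : ε ^ s ≤ |b₀| / (2 * Cb) := by
      calc ε ^ s ≤ ((|b₀| / (2 * Cb)) ^ (1 / s)) ^ s := Real.rpow_le_rpow hε.le h1 hs.le
        _ = _ := by rw [← Real.rpow_mul (by positivity), one_div_mul_cancel hs.ne', Real.rpow_one]
    have h3 : Cb * ε ^ s ≤ |b₀| / 2 := by
      calc Cb * ε ^ s ≤ Cb * (|b₀| / (2 * Cb)) := by gcongr
        _ = _ := by field_simp
    have h4 : |b₀| / 2 ≤ |b| := by
      have := abs_sub_abs_le_abs_sub b₀ b
      rw [abs_sub_comm] at this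
      linarith
    have := Complex.abs_im_le_norm (ε + (b * τ : ℝ) * Complex.I : ℂ)
    simp only [Complex.add_im, Complex.ofReal_im, Complex.im_ofReal_mul, Complex.I_im, mul_one,
      zero_add, abs_mul, abs_of_pos hτ] at this
    exact (mul_le_mul_of_nonneg_right h4 hτ.le).trans this

lemma norm_le_norm_one_add {z : ℂ} (hz : 0 ≤ z.re) : ‖z‖ ≤ ‖1 + z‖ := by
  rw [Complex.norm_def, Complex.norm_def]
  apply Real.sqrt_le_sqrt
  simp only [Complex.normSq_apply, Complex.add_re, Complex.add_im, Complex.one_re, Complex.one_im]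
  nlinarith

set_option maxHeartbeats 1000000 in
/-- uniform estimate for the first-order semi-implicit scheme APSI1.
There are `C, λ₀ > 0` such that, whenever `NΔt = T`, `Δt/ε² ≥ λ₀`, `E` is bounded and
Lipschitz with constant `κ`, `|b̃ − b₀| ≤ C_b ε^s`, and `M_ξ` bounds the noises, the
APSI1 iterates `xⁿ` and the forward-Euler guiding-center iterates `uⁿ` satisfy
`‖x^N − u^N‖ ≤ C[ε²(1 + ‖ε⁻¹v⁰ − R(x⁰)E(x⁰)‖) + M_ξ√(2σε/(τΔt))
  + (ε^sτ² + ε² + ετ)/(ε² + τ²)]`. -/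
theorem stmt_17 (T σ τ s κ Cb b₀ : ℝ)
    (hT : 0 < T) (hσ : 0 < σ) (hτ : 0 < τ) (hs : 0 < s) (hκ : 0 < κ)
    (hCb : 0 < Cb) (hb₀ : b₀ ≠ 0)
    (K : Matrix (Fin 2) (Fin 2) ℝ) (hK : K = !![0, 1; -1, 0]) :
    ∃ C > (0 : ℝ), ∃ lam₀ > (0 : ℝ),
      ∀ (ε Δt : ℝ) (N : ℕ), ε ∈ Set.Ioc (0 : ℝ) 1 → 0 < Δt → (N : ℝ) * Δt = T →
        lam₀ ≤ Δt / ε ^ 2 →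
      ∀ δ lam : ℝ, δ = Δt / ε → lam = Δt / ε ^ 2 →
      ∀ (E : (Fin 2 → ℝ) → (Fin 2 → ℝ)) (btil : (Fin 2 → ℝ) → ℝ),
        (∀ y : Fin 2 → ℝ, enorm2 (E y) ≤ κ) →
        (∀ y y' : Fin 2 → ℝ, enorm2 (E y - E y') ≤ κ * enorm2 (y - y')) →
        (∀ z : Fin 2 → ℝ, |btil z - b₀| ≤ Cb * ε ^ s) →
      ∀ M R : (Fin 2 → ℝ) → Matrix (Fin 2) (Fin 2) ℝ,
        (∀ y : Fin 2 → ℝ,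
          M y = ((1 + δ / τ) ^ 2 + (lam * btil (ε • y)) ^ 2)⁻¹ •
            ((1 + δ / τ) • (1 : Matrix (Fin 2) (Fin 2) ℝ) + (lam * btil (ε • y)) • K)) →
        (∀ y : Fin 2 → ℝ,
          R y = ((btil (ε • y) * τ) ^ 2 + ε ^ 2)⁻¹ •
            ((btil (ε • y) * τ ^ 2) • K + (ε * τ) • (1 : Matrix (Fin 2) (Fin 2) ℝ))) →
      ∀ (ξ : ℕ → Fin 2 → ℝ) (Mξ : ℝ), (∀ n : ℕ, n < N → enorm2 (ξ n) ≤ Mξ) →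
      ∀ (x0 v0 : Fin 2 → ℝ) (x v u : ℕ → Fin 2 → ℝ),
        x 0 = x0 → v 0 = v0 → u 0 = x0 →
        (∀ n : ℕ, v (n + 1) =
          (M (x n)).mulVec (v n + δ • E (x n) + Real.sqrt (2 * σ * δ / τ) • ξ n)) →
        (∀ n : ℕ, x (n + 1) = x n + δ • v (n + 1)) →
        (∀ n : ℕ, u (n + 1) = u n + Δt • (b₀⁻¹ • K.mulVec (E (u n)))) →
        enorm2 (x N - u N)
          ≤ C * (ε ^ 2 * (1 + enorm2 (ε⁻¹ • v 0 - (R (x 0)).mulVec (E (x 0))))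
              + Mξ * Real.sqrt (2 * σ * ε / (τ * Δt))
              + (ε ^ s * τ ^ 2 + ε ^ 2 + ε * τ) / (ε ^ 2 + τ ^ 2)) := by
  subst hK
  obtain ⟨p, hp, hpb⟩ := exists_symbol_lower_bound hτ hs hCb hb₀
  have hb : 0 < |b₀| := abs_pos.mpr hb₀
  set L := |b₀|⁻¹ * κ with hL
  set A := 2 * T * (L * (τ / p * κ) + 2 * L ^ 2) with hA
  set C₁ := (1 + Cb) * (1 + τ ^ 2) / (τ * p * |b₀|) with hC₁
  set C₂ := (1 + τ ^ 2) / p with hC₂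
  have hL0 : 0 < L := by positivity
  have hA0 : 0 < A := by positivity
  refine ⟨Real.exp (L * T) * (2 * (τ / p) + 4 * T * (τ / p) + 2 * T * κ * C₁ + A * C₂),
    by positivity, 4 * τ / p, by positivity, ?_⟩
  rintro ε Δt N ⟨hε, hε1⟩ hΔ hN hlam δ lam rfl rfl E btil hE hEL hbt M R hM hR ξ Mξ hξ x0 v0 x v u
    hx0 - hu0 hv hx hu
  set P := planeToComplex with hP
  set lam := Δt / ε ^ 2 with hlamdef
  have hlam0 : 0 < lam := by positivity
  have hδ : Δt / ε = lam * ε := by rw [hlamdef]; field_simp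
  set θ := (ε ^ s * τ ^ 2 + ε ^ 2 + ε * τ) / (ε ^ 2 + τ ^ 2) with hθ
  have hεs : 0 < ε ^ s := by positivity
  have hθ1 : ε ^ s * τ ^ 2 + ε * τ ≤ (1 + τ ^ 2) * θ := by
    rw [hθ, ← mul_div_assoc, le_div_iff₀ (by positivity)]
    have : ε ^ 2 ≤ 1 := pow_le_one₀ hε.le hε1
    rw [mul_comm]
    gcongr
    linarith [sq_nonneg ε]
  have hθ2 : (τ / p) * ε ^ 2 ≤ C₂ * θ := by
    have : ε ^ 2 * τ ≤ (1 + τ ^ 2) * θ := by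
      have : ε ^ 2 * τ ≤ ε * τ := by gcongr; nlinarith
      have : 0 < ε ^ s * τ ^ 2 := by positivity
      linarith
    rw [hC₂, div_mul_eq_mul_div, div_mul_eq_mul_div]
    refine div_le_div_of_nonneg_right ?_ hp.le
    linarith
  let b : ℕ → ℝ := fun n => btil (ε • x n)
  let S : ℕ → ℂ := fun n => ε + (b n * τ : ℝ) * Complex.I
  have hS : ∀ n, p ≤ ‖S n‖ := fun n => hpb ε _ hε (hbt _)
  have hS0 : ∀ n, S n ≠ 0 := fun n => norm_pos_iff.mp (hp.trans_le (hS n))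
  let m : ℕ → ℂ := fun n => (1 + (lam / τ : ℝ) * S n)⁻¹
  have hden : ∀ n, lam / τ * p ≤ ‖1 + (lam / τ : ℝ) * S n‖ := by
    intro n
    refine le_trans ?_ (norm_le_norm_one_add ?_)
    · rw [norm_mul, Complex.norm_real, Real.norm_of_nonneg (by positivity)]
      gcongr
      exact hS n
    · rw [Complex.re_ofReal_mul]
      have : (S n).re = ε := by simp [S]
      rw [this]
      positivity
  have hden0 : ∀ n, 1 + (lam / τ : ℝ) * S n ≠ 0 := fun n =>
    norm_pos_iff.mp (lt_of_lt_of_le (by positivity) (hden n))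
  set q := τ / (lam * p) with hq
  have hqΔ : q * Δt = τ / p * ε ^ 2 := by rw [hq, hlamdef]; field_simp
  have hm : ∀ n, ‖m n‖ ≤ q := by
    intro n
    have : q = (lam / τ * p)⁻¹ := by rw [hq]; field_simp
    rw [this, norm_inv]
    exact inv_anti₀ (by positivity) (hden n)
  have hPM : ∀ n z, P ((M (x n)).mulVec z) = m n * P z := by
    intro n z
    rw [hM, hP, planeToComplex_mulVec_resolvent, hδ]
    congr 2
    simp only [S, b]
    have : (τ : ℂ) ≠ 0 := by exact_mod_cast hτ.ne'
    push_cast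
    field_simp
    ring
  have hPR : ∀ n z, P ((R (x n)).mulVec z) = τ / S n * P z := by
    intro n z
    have : R (x n) = τ • ((ε ^ 2 + (b n * τ) ^ 2)⁻¹ • (ε • (1 : Matrix (Fin 2) (Fin 2) ℝ) +
        (b n * τ) • !![0, 1; -1, 0])) := by
      rw [hR, add_comm (ε ^ 2)]
      ext i j
      simp only [Matrix.smul_apply, Matrix.add_apply, smul_eq_mul, b]
      ring
    rw [this, Matrix.smul_mulVec, map_smul, hP, planeToComplex_mulVec_resolvent, Complex.real_smul,
      ← mul_assoc, div_eq_mul_inv]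
  have hMξ : 0 ≤ Mξ := by
    refine (Real.sqrt_nonneg _).trans (hξ 0 (Nat.pos_of_ne_zero ?_))
    rintro rfl
    simp at hN
    linarith
  have hkey := norm_sub_le_of_relaxation (x := fun n => P (x n)) (u := fun n => P (u n))
    (w := fun n => P (ε⁻¹ • v n)) (F := fun n => P (E (x n))) (G := fun n => P (E (u n)))
    (R := fun n => τ / S n) (m := m)
    (g := fun n => m n * P (ε⁻¹ • Real.sqrt (2 * σ * (Δt / ε) / τ) • ξ n))
    (k := (b₀⁻¹ : ℝ) * -Complex.I) (N := N) (Δt := Δt) (T := T) (q := q)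
    (η := τ / p * (Mξ * Real.sqrt (2 * σ * ε / (τ * Δt)))) (κ := κ) (ρ := C₁ * θ) (r := τ / p)
    hΔ hN hT (by positivity) ?_ (by positivity) hκ.le (by positivity) (by positivity)
    ?_ hm ?_ ?_ ?_ ?_ ?_ ?_ ?_ ?_ (by simp [hx0, hu0])
  · have hk : ‖((b₀⁻¹ : ℝ) * -Complex.I : ℂ)‖ = |b₀|⁻¹ := by simp
    rw [hk, ← hL, ← hA, hqΔ] at hkey
    rw [← norm_planeToComplex, map_sub]
    refine hkey.trans ?_
    rw [← norm_planeToComplex, map_sub, ← hP, hPR 0]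
    rw [mul_assoc (Real.exp _)]
    refine mul_le_mul_of_nonneg_left ?_ (Real.exp_pos _).le
    set W := ‖P (ε⁻¹ • v 0) - τ / S 0 * P (E (x 0))‖ with hW
    set Q := Mξ * Real.sqrt (2 * σ * ε / (τ * Δt)) with hQ
    have hW0 : 0 ≤ W := norm_nonneg _
    have hQ0 : 0 ≤ Q := by positivity
    have hθ0 : 0 ≤ θ := by positivity
    have a1 := mul_le_mul_of_nonneg_left hθ2 hA0.le
    have hX : 2 * (τ / p * ε ^ 2) * W + 4 * T * (τ / p * Q) + 2 * T * κ * (C₁ * θ) +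
        A * (C₂ * θ) ≤
        (2 * (τ / p) + 4 * T * (τ / p) + 2 * T * κ * C₁ + A * C₂) *
          (ε ^ 2 * (1 + W) + Q + θ) := by
      have c1 : 0 ≤ 2 * (τ / p) := by positivity
      have c2 : 0 ≤ 4 * T * (τ / p) := by positivity
      have c3 : 0 ≤ 2 * T * κ * C₁ + A * C₂ := by positivity
      have e1 : ε ^ 2 * W ≤ ε ^ 2 * (1 + W) + Q + θ := by linarith [sq_nonneg ε]
      have e2 : Q ≤ ε ^ 2 * (1 + W) + Q + θ := by linarith [sq_nonneg ε, mul_nonneg (sq_nonneg ε) hW0]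
      have e3 : θ ≤ ε ^ 2 * (1 + W) + Q + θ := by linarith [sq_nonneg ε, mul_nonneg (sq_nonneg ε) hW0]
      have f1 := mul_le_mul_of_nonneg_left e1 c1
      have f2 := mul_le_mul_of_nonneg_left e2 c2
      have f3 := mul_le_mul_of_nonneg_left e3 c3
      linarith
    linarith
  · rw [hq, div_le_iff₀ (by positivity)]
    rw [div_le_iff₀ hp] at hlam
    linarith
  · intro n
    have h1 : m n * (1 + (lam / τ : ℝ) * S n) = 1 := inv_mul_cancel₀ (hden0 n)
    have h2 : P (ε⁻¹ • v (n + 1)) = m n * (P (ε⁻¹ • v n) + lam * P (E (x n)) +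
        P (ε⁻¹ • Real.sqrt (2 * σ * (Δt / ε) / τ) • ξ n)) := by
      rw [map_smul, hv, hPM, hδ]
      simp only [map_add, map_smul, Complex.real_smul]
      have : (ε : ℂ) ≠ 0 := by exact_mod_cast hε.ne'
      push_cast
      field_simp
    have h3 : (lam : ℂ) = (lam / τ : ℝ) * S n * (τ / S n) := by
      have : (τ : ℂ) ≠ 0 := by exact_mod_cast hτ.ne'
      have := hS0 n
      push_cast
      field_simp
    rw [h2]
    linear_combination m n * P (E (x n)) * h3 + (τ / S n) * P (E (x n)) * h1
  · intro n hn
    have h1 : q * (ε⁻¹ * Real.sqrt (2 * σ * (Δt / ε) / τ)) =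
        τ / p * Real.sqrt (2 * σ * ε / (τ * Δt)) := by
      have : 2 * σ * (Δt / ε) / τ = (Δt / ε) ^ 2 * (2 * σ * ε / (τ * Δt)) := by field_simp
      rw [this, Real.sqrt_mul (by positivity), Real.sqrt_sq (by positivity), hq, hlamdef]
      field_simp
    have h2 : ‖P (ξ n)‖ ≤ Mξ := by rw [hP, norm_planeToComplex]; exact hξ n hn
    rw [norm_mul, map_smul, map_smul, norm_smul, norm_smul, Real.norm_of_nonneg (by positivity),
      Real.norm_of_nonneg (Real.sqrt_nonneg _)]
    calc _ ≤ q * (ε⁻¹ * (Real.sqrt (2 * σ * (Δt / ε) / τ) * Mξ)) := by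
          gcongr
          exact hm n
      _ = q * (ε⁻¹ * Real.sqrt (2 * σ * (Δt / ε) / τ)) * Mξ := by ring
      _ = _ := by rw [h1]; ring
  · intro n
    rw [norm_div, Complex.norm_real, Real.norm_of_nonneg hτ.le]
    exact div_le_div_of_nonneg_left hτ.le hp (hS n)
  · intro n
    have hτc : (τ : ℂ) ≠ 0 := by exact_mod_cast hτ.ne'
    have hbc : (b₀ : ℂ) ≠ 0 := by exact_mod_cast hb₀
    have h1 : τ / S n - (b₀⁻¹ : ℝ) * -Complex.I =
        (Complex.I * ε - ((b n - b₀) * τ : ℝ)) / (S n * b₀) := by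
      have := hS0 n
      push_cast
      field_simp
      simp only [S]
      push_cast
      linear_combination (b n * τ : ℂ) * Complex.I_sq
    have h2 : ‖Complex.I * ε - ((b n - b₀) * τ : ℝ)‖ ≤ (1 + Cb) * ((1 + τ ^ 2) * θ) / τ := by
      refine (norm_sub_le _ _).trans ?_
      rw [norm_mul, Complex.norm_I, one_mul, Complex.norm_real, Complex.norm_real,
        Real.norm_of_nonneg hε.le, norm_mul, Real.norm_of_nonneg hτ.le, Real.norm_eq_abs,
        le_div_iff₀ hτ]
      have h3 := mul_le_mul_of_nonneg_left hθ1 (show 0 ≤ 1 + Cb by positivity)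
      have h4 := mul_le_mul_of_nonneg_right (hbt (ε • x n)) (show 0 ≤ τ * τ by positivity)
      have h5 : 0 < Cb * (ε * τ) := by positivity
      have h6 : 0 < ε ^ s * τ ^ 2 := by positivity
      simp only [b]
      linarith
    rw [h1, norm_div, norm_mul, Complex.norm_real, Real.norm_eq_abs]
    calc _ ≤ (1 + Cb) * ((1 + τ ^ 2) * θ) / τ / (p * |b₀|) := by
          gcongr
          exact hS n
      _ = C₁ * θ := by rw [hC₁]; field_simp
  · intro n
    rw [hP, norm_planeToComplex]
    exact hE _
  · intro n
    rw [← map_sub, ← map_sub, hP, norm_planeToComplex, norm_planeToComplex]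
    exact hEL _ _
  · intro n
    rw [← map_sub, ← map_sub, hP, norm_planeToComplex, norm_planeToComplex]
    exact hEL _ _
  · intro n
    have : (ε : ℂ) ≠ 0 := by exact_mod_cast hε.ne'
    rw [hx, map_add, map_smul, map_smul, Complex.real_smul, Complex.real_smul]
    push_cast
    field_simp
  · intro n
    rw [hu, map_add, map_smul, map_smul, hP, planeToComplex_mulVec_rotation, Complex.real_smul,
      Complex.real_smul, mul_assoc]
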